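/- Let 0 < ℓ < u, p > 1 and 0 ≤ q₁ < q₂ ≤ p−1. Then vol(invbreve S_p^{q₁}(ℓ,u)) − vol(invbreve S_p^{q₂}(ℓ,u)) = (q₂ − q₁)·(u^{p+1} − ℓ^{p+1}) / ((p+1)·(p−q₁+2)·(p−q₂+2)), where vol denotes 3-dimensional Lebesgue volume. -/

import Mathlib

open MeasureTheory

/-- `invbreve S_p^q(ℓ,u)`; real powers (`Real.rpow`, with `0^0 = 1`). -/
noncomputable def invSpq (ℓ u p q : ℝ) : Set (ℝ × ℝ × ℝ) :=
  {s | 0 ≤ s.2.1 ∧ s.1 ^ p ≤ s.2.1 * s.2.2 ^ q ∧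
       s.2.1 ≤ (ℓ ^ p - (u ^ p - ℓ ^ p) / (u - ℓ) * ℓ) * s.2.2
                 + (u ^ p - ℓ ^ p) / (u - ℓ) * s.1 ∧
       ℓ * s.2.2 ≤ s.1 ∧ s.1 ≤ u * s.2.2 ∧ 0 ≤ s.2.2 ∧ s.2.2 ≤ 1}

/-- The convex function `t ↦ t ^ p` lies below its chord over `[ℓ, u]`. -/
lemma rpow_le_chord {ℓ u p t : ℝ} (hℓ : 0 < ℓ) (hℓu : ℓ < u) (hp : 1 ≤ p)
    (h₁ : ℓ ≤ t) (h₂ : t ≤ u) :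
    t ^ p ≤ (ℓ ^ p - (u ^ p - ℓ ^ p) / (u - ℓ) * ℓ) + (u ^ p - ℓ ^ p) / (u - ℓ) * t := by
  have hd : 0 < u - ℓ := sub_pos.2 hℓu
  have h := (convexOn_rpow hp).2 (Set.mem_Ici.2 hℓ.le) (Set.mem_Ici.2 (hℓ.trans hℓu).le)
    (div_nonneg (sub_nonneg.2 h₂) hd.le) (div_nonneg (sub_nonneg.2 h₁) hd.le)
    (by field_simp; ring)
  simp only [smul_eq_mul] at h
  have e : (u - t) / (u - ℓ) * ℓ + (t - ℓ) / (u - ℓ) * u = t := by field_simp; ring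
  rw [e] at h
  refine h.trans (le_of_eq ?_)
  field_simp
  ring

/-- The truncated cone `{(z, x) : 0 < z ≤ 1, ℓ z ≤ x ≤ u z}`. -/
def truncatedCone (ℓ u : ℝ) : Set (ℝ × ℝ) :=
  {w | 0 < w.1 ∧ w.1 ≤ 1 ∧ ℓ * w.1 ≤ w.2 ∧ w.2 ≤ u * w.1}

lemma measurableSet_truncatedCone (ℓ u : ℝ) : MeasurableSet (truncatedCone ℓ u) := by
  unfold truncatedCone
  measurability

/-- After rescaling to the cone, the perspective lower bound is at most the chord. -/
lemma rpow_mul_rpow_neg_le_chord {ℓ u p q : ℝ} (hℓ : 0 < ℓ) (hℓu : ℓ < u) (hp : 1 ≤ p)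
    (hq : q ≤ p - 1) {w : ℝ × ℝ} (hw : w ∈ truncatedCone ℓ u) :
    w.2 ^ p * w.1 ^ (-q) ≤ (ℓ ^ p - (u ^ p - ℓ ^ p) / (u - ℓ) * ℓ) * w.1
      + (u ^ p - ℓ ^ p) / (u - ℓ) * w.2 := by
  obtain ⟨z, x⟩ := w
  obtain ⟨h0, h1, h2, h3⟩ := hw
  simp only at h0 h1 h2 h3 ⊢
  have hx : 0 < x := (mul_pos hℓ h0).trans_le h2
  have hc := rpow_le_chord hℓ hℓu hp ((le_div_iff₀ h0).2 h2) ((div_le_iff₀ h0).2 h3)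
  have hz : z ^ (p - q) ≤ z := by
    simpa using Real.rpow_le_rpow_of_exponent_ge h0 h1 (show (1 : ℝ) ≤ p - q by linarith)
  have e : x ^ p * z ^ (-q) = (x / z) ^ p * z ^ (p - q) := by
    rw [Real.div_rpow hx.le h0.le, sub_eq_add_neg, Real.rpow_add h0]
    have := (Real.rpow_pos_of_pos h0 p).ne'
    field_simp
  rw [e]
  calc (x / z) ^ p * z ^ (p - q) ≤ (x / z) ^ p * z := by gcongr
    _ ≤ _ := mul_le_mul_of_nonneg_right hc h0.le
    _ = _ := by field_simp

lemma integrableOn_truncatedCone_chord {ℓ u : ℝ} (hℓ : 0 < ℓ) (hℓu : ℓ < u) (a b : ℝ) :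
    IntegrableOn (fun w : ℝ × ℝ => a * w.1 + b * w.2) (truncatedCone ℓ u) := by
  have hc : Continuous (fun w : ℝ × ℝ => a * w.1 + b * w.2) := by fun_prop
  refine (hc.continuousOn.integrableOn_compact (isCompact_Icc (a := (0 : ℝ × ℝ)) (b := (1, u)))
    ).mono_set ?_
  rintro ⟨z, x⟩ ⟨h0, h1, h2, h3⟩
  simp only at h0 h1 h2 h3
  refine ⟨⟨h0.le, ?_⟩, ⟨h1, ?_⟩⟩
  · exact (mul_pos hℓ h0).le.trans h2
  · exact h3.trans (mul_le_of_le_one_right (hℓ.trans hℓu).le h1)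

lemma integrableOn_truncatedCone_rpow {ℓ u p q : ℝ} (hℓ : 0 < ℓ) (hℓu : ℓ < u) (hp : 1 ≤ p)
    (hq : q ≤ p - 1) :
    IntegrableOn (fun w : ℝ × ℝ => w.2 ^ p * w.1 ^ (-q)) (truncatedCone ℓ u) := by
  refine (integrableOn_truncatedCone_chord hℓ hℓu (ℓ ^ p - (u ^ p - ℓ ^ p) / (u - ℓ) * ℓ)
      ((u ^ p - ℓ ^ p) / (u - ℓ))).mono'
    (Measurable.aestronglyMeasurable (by fun_prop))
    ((ae_restrict_iff' (measurableSet_truncatedCone ℓ u)).2 (.of_forall fun w hw => ?_))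
  have h0 := hw.1
  have hx : 0 < w.2 := (mul_pos hℓ h0).trans_le hw.2.2.1
  rw [Real.norm_of_nonneg (by positivity)]
  exact rpow_mul_rpow_neg_le_chord hℓ hℓu hp hq hw

lemma setIntegral_truncatedCone_rpow {ℓ u p q : ℝ} (hℓ : 0 < ℓ) (hℓu : ℓ < u) (hp : 1 ≤ p)
    (hq : q ≤ p - 1) :
    ∫ w in truncatedCone ℓ u, w.2 ^ p * w.1 ^ (-q)
      = (u ^ (p + 1) - ℓ ^ (p + 1)) / ((p + 1) * (p - q + 2)) := by
  have hm := measurableSet_truncatedCone ℓ u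
  have hi := (integrable_indicator_iff hm).2 (integrableOn_truncatedCone_rpow hℓ hℓu hp hq)
  have hs : ∀ z : ℝ, ∫ x, (truncatedCone ℓ u).indicator (fun w => w.2 ^ p * w.1 ^ (-q)) (z, x)
      = (Set.Ioc (0 : ℝ) 1).indicator
        (fun z => (u ^ (p + 1) - ℓ ^ (p + 1)) / (p + 1) * z ^ (p - q + 1)) z := by
    intro z
    by_cases hz : z ∈ Set.Ioc (0 : ℝ) 1
    · have h0 := hz.1
      have e : (fun x => (truncatedCone ℓ u).indicator
          (fun w => w.2 ^ p * w.1 ^ (-q)) (z, x))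
          = (Set.Icc (ℓ * z) (u * z)).indicator (fun x => x ^ p * z ^ (-q)) := by
        ext x
        simp only [Set.indicator, truncatedCone, Set.mem_ofPred_eq, hz.1, hz.2, true_and,
          Set.mem_Icc]
      rw [Set.indicator_of_mem hz, e, integral_indicator measurableSet_Icc,
        integral_Icc_eq_integral_Ioc,
        ← intervalIntegral.integral_of_le (by gcongr), intervalIntegral.integral_mul_const,
        integral_rpow (Or.inl (by linarith)), Real.mul_rpow (by linarith) h0.le,
        Real.mul_rpow hℓ.le h0.le, show p - q + 1 = (p + 1) + (-q) by ring,
        Real.rpow_add h0 (p + 1)]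
      ring
    · rw [Set.indicator_of_notMem hz]
      refine integral_eq_zero_of_ae (.of_forall fun x => Set.indicator_of_notMem ?_ _)
      exact fun h => hz ⟨h.1, h.2.1⟩
  rw [← integral_indicator hm, Measure.volume_eq_prod, integral_prod _ hi]
  simp_rw [hs]
  rw [integral_indicator measurableSet_Ioc, ← intervalIntegral.integral_of_le zero_le_one,
    intervalIntegral.integral_const_mul, integral_rpow (Or.inl (by linarith)),
    Real.one_rpow, Real.zero_rpow (by linarith)]
  have : p + 1 ≠ 0 := by linarith
  have : p - q + 2 ≠ 0 := by linarith
  rw [show p - q + 1 + 1 = p - q + 2 by ring]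
  field_simp
  ring

lemma measurableSet_invSpq (ℓ u p q : ℝ) : MeasurableSet (invSpq ℓ u p q) := by
  simp only [invSpq, Set.ofPred_and]
  measurability

lemma measurePreserving_rotate :
    MeasurePreserving (fun s : (ℝ × ℝ) × ℝ => ((s.1.2, s.2, s.1.1) : ℝ × ℝ × ℝ)) := by
  have h₁ : MeasurePreserving (Prod.swap : (ℝ × ℝ) × ℝ → ℝ × (ℝ × ℝ)) volume volume :=
    Measure.measurePreserving_swap
  have h₂ : MeasurePreserving (MeasurableEquiv.prodAssoc.symm : ℝ × (ℝ × ℝ) → (ℝ × ℝ) × ℝ)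
      volume volume := (volume_preserving_prodAssoc (α₁ := ℝ) (β₁ := ℝ) (γ₁ := ℝ)).symm
  exact h₁.comp (h₂.comp h₁)

/-- The volume of `invSpq` as an integral of the height over the truncated cone. -/
lemma volume_invSpq_toReal {ℓ u p q : ℝ} (hℓ : 0 < ℓ) (hℓu : ℓ < u) (hp : 1 ≤ p)
    (hq : q ≤ p - 1) :
    (volume (invSpq ℓ u p q)).toReal = ∫ w in truncatedCone ℓ u,
      (((ℓ ^ p - (u ^ p - ℓ ^ p) / (u - ℓ) * ℓ) * w.1 + (u ^ p - ℓ ^ p) / (u - ℓ) * w.2)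
        - w.2 ^ p * w.1 ^ (-q)) := by
  have hm := measurableSet_truncatedCone ℓ u
  have hS := measurableSet_invSpq ℓ u p q
  have hnull : ∀ᵐ w : ℝ × ℝ, w.1 ≠ 0 := by
    rw [Measure.volume_eq_prod]
    exact Measure.quasiMeasurePreserving_fst.ae (Measure.ae_ne volume 0)
  rw [← measurePreserving_rotate.measure_preimage hS.nullMeasurableSet,
    Measure.volume_eq_prod, Measure.prod_apply (measurePreserving_rotate.measurable hS),
    integral_eq_lintegral_of_nonneg_ae, ← lintegral_indicator hm]
  · congr 1
    refine lintegral_congr_ae (hnull.mono fun w hw0 => ?_)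
    by_cases hw : w ∈ truncatedCone ℓ u
    · have h0 := hw.1
      have hx : 0 < w.2 := (mul_pos hℓ h0).trans_le hw.2.2.1
      simp only [Set.indicator_of_mem hw]
      rw [← Real.volume_Icc]
      congr 1
      ext y
      have e : w.2 ^ p ≤ y * w.1 ^ q ↔ w.2 ^ p * w.1 ^ (-q) ≤ y := by
        rw [Real.rpow_neg h0.le, ← div_eq_mul_inv, div_le_iff₀ (Real.rpow_pos_of_pos h0 q)]
      simp only [invSpq, Set.mem_preimage, Set.mem_ofPred_eq, Set.mem_Icc, e]
      constructor
      · rintro ⟨-, h₁, h₂, -⟩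
        exact ⟨h₁, h₂⟩
      · rintro ⟨h₁, h₂⟩
        exact ⟨le_trans (by positivity) h₁, h₁, h₂, hw.2.2.1, hw.2.2.2, h0.le, hw.2.1⟩
    · simp only [Set.indicator_of_notMem hw]
      convert measure_empty (μ := (volume : Measure ℝ))
      refine Set.eq_empty_of_forall_notMem fun y hy => hw ?_
      obtain ⟨-, -, -, h₁, h₂, h₃, h₄⟩ := hy
      exact ⟨lt_of_le_of_ne h₃ (Ne.symm hw0), h₄, h₁, h₂⟩
  · exact (ae_restrict_iff' hm).2 (.of_forall fun w hw =>
      sub_nonneg.2 (rpow_mul_rpow_neg_le_chord hℓ hℓu hp hq hw))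
  · exact Measurable.aestronglyMeasurable (by fun_prop)

theorem invSpq_volume_difference (ℓ u p q₁ q₂ : ℝ) (hℓ : 0 < ℓ) (hℓu : ℓ < u)
    (hp : 1 < p) (hq₁ : 0 ≤ q₁) (hq₁₂ : q₁ < q₂) (hq₂ : q₂ ≤ p - 1) :
    (volume (invSpq ℓ u p q₁)).toReal - (volume (invSpq ℓ u p q₂)).toReal
    = (q₂ - q₁) * (u ^ (p + 1) - ℓ ^ (p + 1))
        / ((p + 1) * (p - q₁ + 2) * (p - q₂ + 2)) := by
  have hq₁' : q₁ ≤ p - 1 := hq₁₂.le.trans hq₂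
  rw [volume_invSpq_toReal hℓ hℓu hp.le hq₁', volume_invSpq_toReal hℓ hℓu hp.le hq₂,
    integral_sub (integrableOn_truncatedCone_chord hℓ hℓu _ _)
      (integrableOn_truncatedCone_rpow hℓ hℓu hp.le hq₁'),
    integral_sub (integrableOn_truncatedCone_chord hℓ hℓu _ _)
      (integrableOn_truncatedCone_rpow hℓ hℓu hp.le hq₂),
    setIntegral_truncatedCone_rpow hℓ hℓu hp.le hq₁',
    setIntegral_truncatedCone_rpow hℓ hℓu hp.le hq₂]
  have h₁ : p + 1 ≠ 0 := by linarith
  have h₂ : p - q₁ + 2 ≠ 0 := by linarith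
  have h₃ : p - q₂ + 2 ≠ 0 := by linarith
  field_simp
  ring
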